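/- arXiv:1602.04968 — 2 statements merged into one kernel-verified Lean document; each statement's English description precedes it below -/
import Mathlib

section
/- Let n ≥ 1, let 1 ≤ k ≤ n, and let Φ : B_H → B_H be an ℝ-linear map that maps the set P_k of rank-k Hermitian projections bijectively onto itself. Then Φ preserves orthogonality on P_k: for all P, Q ∈ P_k with P * Q = 0, one has Φ(P) * Φ(Q) = 0. -/
open Matrix

noncomputable section

/-- `BH n` is the real vector space of `n × n` complex Hermitian (self-adjoint) matrices. -/
abbrev BH (n : ℕ) := selfAdjoint (Matrix (Fin n) (Fin n) ℂ)

/-- `projSet n k` is the set of rank-`k` Hermitian projections, viewed inside `BH n`. -/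
def projSet (n k : ℕ) : Set (BH n) :=
  {P | (P : Matrix (Fin n) (Fin n) ℂ) * (P : Matrix (Fin n) (Fin n) ℂ) = (P : Matrix (Fin n) (Fin n) ℂ)
    ∧ (P : Matrix (Fin n) (Fin n) ℂ).rank = k}

lemma rank_eq_trace_aux {ι : Type*} [Fintype ι] [DecidableEq ι] (A : Matrix ι ι ℂ)
    (h : A * A = A) : (A.rank : ℂ) = A.trace := by
  have h1 : IsIdempotentElem (Matrix.toLin' A) := by
    unfold IsIdempotentElem
    rw [Module.End.mul_eq_comp, ← Matrix.toLin'_mul, h]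
  have h2 := LinearMap.IsProj.trace (LinearMap.IsIdempotentElem.isProj_range _ h1)
  rw [Matrix.trace_toLin'_eq] at h2
  rw [h2]; rfl

lemma mem_projSet_iff_aux {n k : ℕ} (P : BH n) :
    P ∈ projSet n k ↔ (P : Matrix (Fin n) (Fin n) ℂ) * P = P ∧
      (P : Matrix (Fin n) (Fin n) ℂ).trace = k := by
  unfold projSet
  constructor
  · rintro ⟨h, h2⟩
    exact ⟨h, by rw [← rank_eq_trace_aux _ h, h2]⟩
  · rintro ⟨h, h2⟩
    refine ⟨h, ?_⟩
    rw [← rank_eq_trace_aux _ h] at h2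
    exact_mod_cast h2

/-- A rank `k` projection is `p pᴴ` with `p` an isometry. -/
lemma exists_isometry_aux {n k : ℕ} (P : BH n) (hP : P ∈ projSet n k) :
    ∃ p : Matrix (Fin n) (Fin k) ℂ, pᴴ * p = 1 ∧ p * pᴴ = (P : Matrix (Fin n) (Fin n) ℂ) := by
  have hP' := (mem_projSet_iff_aux P).1 hP
  obtain ⟨hid, hrk⟩ := hP
  have hH : (P : Matrix (Fin n) (Fin n) ℂ)ᴴ = P := P.2
  set A : Matrix (Fin n) (Fin n) ℂ := P.1 with hA
  let V := LinearMap.range (Matrix.toEuclideanLin A)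
  have hV : Module.finrank ℂ V = k := by
    rw [← hrk, A.rank_eq_finrank_range_toLin (EuclideanSpace.basisFun (Fin n) ℂ).toBasis
      (EuclideanSpace.basisFun (Fin n) ℂ).toBasis]
    rw [← Matrix.toEuclideanLin_eq_toLin_orthonormal]
  let b := (stdOrthonormalBasis ℂ V).reindex (finCongr hV)
  let p : Matrix (Fin n) (Fin k) ℂ := fun i j => (b j : EuclideanSpace ℂ (Fin n)) i
  have hpp : pᴴ * p = 1 := by
    ext i j
    have := (orthonormal_iff_ite.1 b.orthonormal) i j
    rw [Matrix.one_apply, ← this, Matrix.mul_apply]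
    simp only [Submodule.coe_inner, PiLp.inner_apply, Matrix.conjTranspose_apply, p]
    refine Finset.sum_congr rfl fun x _ => ?_
    have e : (fun i j => (b j : EuclideanSpace ℂ (Fin n)) i : Matrix (Fin n) (Fin k) ℂ)ᴴ i x =
        star ((b i : EuclideanSpace ℂ (Fin n)) x) := rfl
    rw [e]
    simp [mul_comm]
  have hAp : A * p = p := by
    ext i j
    obtain ⟨y, hy⟩ := (b j).2
    have h1 : Matrix.toEuclideanLin A (b j : EuclideanSpace ℂ (Fin n)) = b j := by
      rw [← hy, Matrix.toEuclideanLin_apply, Matrix.toEuclideanLin_apply]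
      simp [Matrix.mulVec_mulVec, hid]
    have h2 := congrArg (fun v : EuclideanSpace ℂ (Fin n) => v i) h1
    simp only [Matrix.toEuclideanLin_apply] at h2
    rw [Matrix.mul_apply]
    exact h2
  refine ⟨p, hpp, ?_⟩
  have hpA : pᴴ * A = pᴴ := by
    have := congrArg Matrix.conjTranspose hAp
    rwa [Matrix.conjTranspose_mul, hH] at this
  have hz : A - p * pᴴ = 0 := by
    open ComplexOrder in
    refine Matrix.trace_conjTranspose_mul_self_eq_zero_iff.1 ?_
    have : (A - p * pᴴ)ᴴ * (A - p * pᴴ) = A - p * pᴴ := by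
      rw [Matrix.conjTranspose_sub, Matrix.conjTranspose_mul, Matrix.conjTranspose_conjTranspose, hH,
        sub_mul, mul_sub, mul_sub, hid, ← Matrix.mul_assoc, hAp, Matrix.mul_assoc, hpA,
        Matrix.mul_assoc, ← Matrix.mul_assoc pᴴ, hpp, Matrix.one_mul]
      simp
    rw [this, Matrix.trace_sub, hP'.2, Matrix.trace_mul_comm, hpp]
    simp
  exact (sub_eq_zero.1 hz).symm

lemma factor_aux {n : ℕ} {ι : Type*} [Fintype ι] [DecidableEq ι] (B : Matrix ι (Fin n) ℂ)
    (X : Matrix (Fin n) (Fin n) ℂ) (h : ∀ v, B *ᵥ v = 0 → X *ᵥ v = 0) :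
    ∃ Y : Matrix (Fin n) ι ℂ, X = Y * B := by
  let f := Matrix.toLin' B
  obtain ⟨g, hg⟩ := LinearMap.exists_rightInverse_of_surjective f.rangeRestrict
    f.range_rangeRestrict
  obtain ⟨y, hy⟩ := LinearMap.exists_extend ((Matrix.toLin' X).comp g)
  refine ⟨LinearMap.toMatrix' y, ?_⟩
  apply Matrix.toLin'.injective
  rw [Matrix.toLin'_mul, Matrix.toLin'_toMatrix']
  ext1 v'
  ext1
  simp only [LinearMap.comp_apply]
  generalize LinearMap.single ℂ (fun _ => ℂ) v' 1 = v
  have h1 : y (f v) = Matrix.toLin' X (g (f.rangeRestrict v)) :=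
    LinearMap.congr_fun hy (f.rangeRestrict v)
  have h2 : f (g (f.rangeRestrict v)) = f v :=
    congrArg Subtype.val (LinearMap.congr_fun hg (f.rangeRestrict v))
  have h3 := h (v - g (f.rangeRestrict v)) (by
    have : f (v - g (f.rangeRestrict v)) = 0 := by rw [map_sub, h2, sub_self]
    simpa [f] using this)
  rw [Matrix.mulVec_sub, sub_eq_zero] at h3
  change _ = y (f v)
  rw [h1]
  simpa using h3

/-- `X + Z = W Wᴴ` forces `X` to be of the form `W H Wᴴ`. -/
lemma sandwich_aux {n : ℕ} {ι : Type*} [Fintype ι] [DecidableEq ι] (W : Matrix (Fin n) ι ℂ)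
    (X Z : Matrix (Fin n) (Fin n) ℂ) (hX : Xᴴ = X) (hX2 : X * X = X) (hZ : Zᴴ = Z)
    (hZ2 : Z * Z = Z) (h : X + Z = W * Wᴴ) :
    ∃ H : Matrix ι ι ℂ, Hᴴ = H ∧ X = W * H * Wᴴ := by
  obtain ⟨Y, hY⟩ := factor_aux Wᴴ X (by
    intro v hv
    have h0 : (X + Z) *ᵥ v = 0 := by
      rw [h, ← Matrix.mulVec_mulVec, hv, Matrix.mulVec_zero]
    have key : ∀ T : Matrix (Fin n) (Fin n) ℂ, Tᴴ = T → T * T = T →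
        star (T *ᵥ v) ⬝ᵥ (T *ᵥ v) = star v ⬝ᵥ (T *ᵥ v) := by
      intro T h1 h2
      rw [Matrix.star_mulVec, ← Matrix.dotProduct_mulVec, Matrix.mulVec_mulVec, h1, h2]
    have hs : star (X *ᵥ v) ⬝ᵥ (X *ᵥ v) + star (Z *ᵥ v) ⬝ᵥ (Z *ᵥ v) = 0 := by
      rw [key X hX hX2, key Z hZ hZ2, ← dotProduct_add, ← Matrix.add_mulVec, h0, dotProduct_zero]
    open ComplexOrder in
    exact dotProduct_star_self_eq_zero.1 ((add_eq_zero_iff_of_nonneg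
      (dotProduct_star_self_nonneg _) (dotProduct_star_self_nonneg _)).1 hs).1)
  refine ⟨Yᴴ * Y, by simp, ?_⟩
  calc X = Xᴴ * X := by rw [hX, hX2]
    _ = _ := by rw [hY]; simp [Matrix.mul_assoc]

/-- the linear constraint -/
lemma constraint_aux {n : ℕ} (X Z M : Matrix (Fin n) (Fin n) ℂ) (hX2 : X * X = X)
    (hZ2 : Z * Z = Z) (h : X + Z = M) : X * (M - 1) + (M - 1) * X = M * (M - 1) := by
  subst h
  have : X * X = X := hX2
  simp only [mul_sub, sub_mul, mul_add, add_mul, hX2, hZ2, mul_one, one_mul]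
  abel

lemma indicator_span_aux {ι : Type*} [Fintype ι] [DecidableEq ι] (k : ℕ) (hk : 1 ≤ k)
    (hc : Fintype.card ι = k + k) (T : Submodule ℝ (ι → ℝ))
    (hT : ∀ s : Finset ι, s.card = k → (fun i => if i ∈ s then (1:ℝ) else 0) ∈ T) : T = ⊤ := by
  have hdiff : ∀ i j, (Pi.single i 1 - Pi.single j 1 : ι → ℝ) ∈ T := by
    intro i j
    by_cases hij : i = j
    · subst hij; simp
    have hcard : k - 1 ≤ ((Finset.univ.erase i).erase j).card := by
      rw [Finset.card_erase_of_mem (by simp [Ne.symm hij]), Finset.card_erase_of_mem (by simp),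
        Finset.card_univ, hc]
      omega
    obtain ⟨t, ht, htc⟩ := Finset.exists_subset_card_eq hcard
    have hi : i ∉ t := fun h => by simpa using ht h
    have hj : j ∉ t := fun h => by simpa using ht h
    have h1 := hT (insert i t) (by rw [Finset.card_insert_of_notMem hi]; omega)
    have h2 := hT (insert j t) (by rw [Finset.card_insert_of_notMem hj]; omega)
    convert T.sub_mem h1 h2 using 1
    ext x
    by_cases hxi : x = i
    · subst hxi; simp [hij, hi]
    · by_cases hxj : x = j
      · subst hxj; simp [hxi, hj]
      · simp [hxi, hxj]
  obtain ⟨s, -, hs⟩ := Finset.exists_subset_card_eq (s := (Finset.univ : Finset ι)) (n := k)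
    (by rw [Finset.card_univ, hc]; omega)
  have hsingle : ∀ i, (Pi.single i 1 : ι → ℝ) ∈ T := by
    intro i
    have h1 := T.smul_mem (k : ℝ)⁻¹ (T.add_mem (hT s hs)
      (T.sum_mem (t := s) (f := fun j => (Pi.single i 1 - Pi.single j 1 : ι → ℝ)) fun j _ => hdiff i j))
    convert h1 using 1
    have hk0 : (k : ℝ) ≠ 0 := by positivity
    ext x
    simp [Finset.sum_sub_distrib, Pi.single_apply, hs]
    split_ifs <;> field_simp
  rw [eq_top_iff]
  intro f _
  have : f = ∑ i, f i • (Pi.single i 1 : ι → ℝ) := by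
    ext x; simp [Pi.single_apply]
  rw [this]
  exact T.sum_mem fun i _ => T.smul_mem _ (hsingle i)

lemma hermitian_span_aux {ι : Type*} [Fintype ι] [DecidableEq ι] (k : ℕ) (hk : 1 ≤ k)
    (hc : Fintype.card ι = k + k) (T : Submodule ℝ (Matrix ι ι ℂ))
    (hT : ∀ h : Matrix ι ι ℂ, hᴴ = h → h * h = h → h.trace = k → h ∈ T)
    (H : Matrix ι ι ℂ) (hH : Hᴴ = H) : H ∈ T := by
  have hH' : H.IsHermitian := hH
  set U : Matrix ι ι ℂ := hH'.eigenvectorUnitary.1 with hU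
  have hUU : Uᴴ * U = 1 := (Matrix.mem_unitaryGroup_iff').1 hH'.eigenvectorUnitary.2
  have hspec : H = U * diagonal (fun i => ((hH'.eigenvalues i : ℝ) : ℂ)) * Uᴴ :=
    hH'.spectral_theorem
  let F : (ι → ℝ) →ₗ[ℝ] Matrix ι ι ℂ :=
    { toFun := fun d => U * diagonal (fun i => ((d i : ℝ) : ℂ)) * Uᴴ
      map_add' := by
        intro a b
        rw [← add_mul, ← mul_add, diagonal_add]
        simp
      map_smul' := by
        intro c a
        simp only [RingHom.id_apply]
        rw [← Matrix.smul_mul, ← Matrix.mul_smul, ← diagonal_smul]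
        congr 3
        ext i
        simp }
  have htop := indicator_span_aux k hk hc (T.comap F) (by
    intro s hs
    rw [Submodule.mem_comap]
    have hd : F (fun i => if i ∈ s then (1:ℝ) else 0) =
      U * diagonal (fun i => if i ∈ s then (1:ℂ) else 0) * Uᴴ := by
        simp only [F, LinearMap.coe_mk, AddHom.coe_mk]
        congr 3
        ext i
        split_ifs <;> simp
    rw [hd]
    apply hT
    · simp only [conjTranspose_mul, conjTranspose_conjTranspose, diagonal_conjTranspose,
        Matrix.mul_assoc]
      congr 3
      ext i
      simp only [Pi.star_apply]
      split_ifs <;> simp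
    · calc _ = U * (diagonal (fun i => if i ∈ s then (1:ℂ) else 0) * (Uᴴ * U) *
              diagonal (fun i => if i ∈ s then (1:ℂ) else 0)) * Uᴴ := by
            simp only [Matrix.mul_assoc]
        _ = _ := by
            rw [hUU, Matrix.mul_one, diagonal_mul_diagonal]
            congr 3
            ext i
            split_ifs <;> simp
    · rw [Matrix.trace_mul_comm, ← Matrix.mul_assoc, hUU, Matrix.one_mul, trace_diagonal]
      simp [hs])
  have : hH'.eigenvalues ∈ T.comap F := by rw [htop]; trivial
  rw [hspec]
  exact this

lemma hermitian_span_aux' {ι : Type*} [Fintype ι] [DecidableEq ι] (k : ℕ) (hk : 1 ≤ k)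
    (hc : Fintype.card ι = k + k) (T : Submodule ℝ (selfAdjoint (Matrix ι ι ℂ)))
    (hT : ∀ h : selfAdjoint (Matrix ι ι ℂ), (h : Matrix ι ι ℂ) * h = h →
      (h : Matrix ι ι ℂ).trace = k → h ∈ T)
    (H : selfAdjoint (Matrix ι ι ℂ)) : H ∈ T := by
  let inc : selfAdjoint (Matrix ι ι ℂ) →ₗ[ℝ] Matrix ι ι ℂ :=
    (selfAdjoint.submodule ℝ (Matrix ι ι ℂ)).subtype
  have := hermitian_span_aux k hk hc (T.map inc) (by
    intro h h1 h2 h3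
    exact ⟨⟨h, h1⟩, hT ⟨h, h1⟩ h2 h3, rfl⟩) H.1 H.2
  obtain ⟨y, hy, hyH⟩ := this
  have : y = H := Subtype.ext hyH
  rwa [← this]

/-- The map `H ↦ W H Wᴴ` on Hermitian matrices. -/
def sandLin {n : ℕ} {ι : Type*} [Fintype ι] [DecidableEq ι] (W : Matrix (Fin n) ι ℂ) :
    selfAdjoint (Matrix ι ι ℂ) →ₗ[ℝ] BH n where
  toFun H := ⟨W * H.1 * Wᴴ, by
    have : H.1ᴴ = H.1 := H.2
    change (W * H.1 * Wᴴ)ᴴ = _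
    simp [Matrix.mul_assoc, this]⟩
  map_add' a b := by
    apply Subtype.ext
    simp [mul_add, add_mul, Matrix.mul_add, Matrix.add_mul]
  map_smul' c a := by
    apply Subtype.ext
    simp

lemma sandLin_coe {n : ℕ} {ι : Type*} [Fintype ι] [DecidableEq ι] (W : Matrix (Fin n) ι ℂ)
    (H : selfAdjoint (Matrix ι ι ℂ)) :
    (sandLin W H : Matrix (Fin n) (Fin n) ℂ) = W * H.1 * Wᴴ := rfl

lemma injOn_span_aux {n k : ℕ} (Φ : BH n →ₗ[ℝ] BH n)
    (hΦ : Set.BijOn Φ (projSet n k) (projSet n k)) (x : BH n)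
    (hx : x ∈ Submodule.span ℝ (projSet n k)) (h : Φ x = 0) : x = 0 := by
  have hfd : FiniteDimensional ℝ (BH n) :=
    inferInstanceAs (FiniteDimensional ℝ (selfAdjoint.submodule ℝ (Matrix (Fin n) (Fin n) ℂ)))
  set U := Submodule.span ℝ (projSet n k) with hU
  have hmap : U.map Φ = U := by
    rw [hU, Submodule.map_span, hΦ.image_eq]
  have hmem : ∀ y ∈ U, Φ y ∈ U := fun y hy => by
    rw [← hmap]; exact ⟨y, hy, rfl⟩
  have hsurj : Function.Surjective (Φ.restrict hmem) := by
    rintro ⟨y, hy⟩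
    rw [← hmap] at hy
    obtain ⟨z, hz, rfl⟩ := hy
    exact ⟨⟨z, hz⟩, rfl⟩
  have hinj := LinearMap.injective_iff_surjective.2 hsurj
  have : (⟨x, hx⟩ : U) = 0 := hinj (by
    apply Subtype.ext
    simp [h])
  exact congrArg Subtype.val this

/-- The submodule cut out by the linear constraint. -/
def constrSub {n : ℕ} (k : ℕ) (M : Matrix (Fin n) (Fin n) ℂ) : Submodule ℝ (BH n) where
  carrier := {A | (k : ℂ) • (A.1 * (M - 1) + (M - 1) * A.1) = A.1.trace • (M * (M - 1))}
  add_mem' := by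
    intro a b ha hb
    simp only [Set.mem_setOf_eq] at ha hb ⊢
    rw [AddSubgroup.coe_add, Matrix.trace_add, add_smul, ← ha, ← hb, ← smul_add, add_mul, mul_add]
    congr 1
    abel
  zero_mem' := by simp
  smul_mem' := by
    intro c a ha
    simp only [Set.mem_setOf_eq] at ha ⊢
    rw [selfAdjoint.val_smul, Matrix.trace_smul, smul_assoc, ← ha, Matrix.smul_mul, Matrix.mul_smul,
      ← smul_add, smul_comm]

/-- The endgame: the constraint on all Hermitian `H` forces the Gram matrix to be `1`. -/
lemma gram_aux {ι : Type*} [Fintype ι] [DecidableEq ι] (k : ℕ) (hk : 1 ≤ k) (G : Matrix ι ι ℂ)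
    (hG : ∀ i, G i i = 1)
    (h : ∀ H : Matrix ι ι ℂ, Hᴴ = H →
      (k : ℂ) • (H * (G - 1) + (G - 1) * H) = (H * G).trace • (G - 1)) : G = 1 := by
  have hall : ∀ H : Matrix ι ι ℂ,
      (k : ℂ) • (H * (G - 1) + (G - 1) * H) = (H * G).trace • (G - 1) := by
    intro H
    have h1 := h (H + Hᴴ) (by simp [add_comm])
    have h2 := h (Complex.I • (H - Hᴴ)) (by
      simp only [conjTranspose_smul, conjTranspose_sub, conjTranspose_conjTranspose]
      rw [← neg_sub H, smul_neg]; simp)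
    simp only [Matrix.smul_mul, Matrix.mul_smul, trace_smul, ← smul_add, smul_assoc] at h2
    rw [smul_comm] at h2
    have h3 := smul_right_injective _ Complex.I_ne_zero h2
    have h4 : (2:ℂ) • H = (H + Hᴴ) + (H - Hᴴ) := by rw [two_smul]; abel
    have h5 : (k : ℂ) • (((2:ℂ) • H) * (G - 1) + (G - 1) * ((2:ℂ) • H)) =
        (((2:ℂ) • H) * G).trace • (G - 1) := by
      rw [h4, add_mul _ _ G, trace_add, add_smul, ← h1, ← h3, ← smul_add, add_mul, mul_add]
      congr 1
      abel
    simp only [Matrix.smul_mul, Matrix.mul_smul, trace_smul, ← smul_add, smul_assoc] at h5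
    rw [smul_comm] at h5
    exact smul_right_injective _ (two_ne_zero) h5
  ext j i
  by_cases hij : j = i
  · subst hij; simp [hG]
  have h1 := congrFun (congrFun (hall (Matrix.single i j 1)) i) i
  have hk0 : (k : ℂ) ≠ 0 := by exact_mod_cast (by omega : k ≠ 0)
  simp [Matrix.mul_apply, Matrix.single_apply, hG, hij, Matrix.one_apply, hk0] at h1
  simp [Matrix.one_apply, hij, h1]

theorem stmt_0 (n k : ℕ) (hn : 1 ≤ n) (hk1 : 1 ≤ k) (hkn : k ≤ n)
    (Φ : BH n →ₗ[ℝ] BH n)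
    (hΦ : Set.BijOn Φ (projSet n k) (projSet n k)) :
    ∀ P ∈ projSet n k, ∀ Q ∈ projSet n k,
      (P : Matrix (Fin n) (Fin n) ℂ) * (Q : Matrix (Fin n) (Fin n) ℂ) = 0 →
      (Φ P : Matrix (Fin n) (Fin n) ℂ) * (Φ Q : Matrix (Fin n) (Fin n) ℂ) = 0 := by
  intro P hP Q hQ hPQ
  obtain ⟨p, hpp, hpP⟩ := exists_isometry_aux P hP
  obtain ⟨q, hqq, hqQ⟩ := exists_isometry_aux Q hQ
  obtain ⟨p', hpp', hpP'⟩ := exists_isometry_aux (Φ P) (hΦ.mapsTo hP)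
  obtain ⟨q', hqq', hqQ'⟩ := exists_isometry_aux (Φ Q) (hΦ.mapsTo hQ)
  have hpq : pᴴ * q = 0 := by
    calc pᴴ * q = (pᴴ * p) * pᴴ * (q * (qᴴ * q)) := by rw [hpp, hqq]; simp
      _ = pᴴ * ((p * pᴴ) * (q * qᴴ)) * q := by simp only [Matrix.mul_assoc]
      _ = 0 := by rw [hpP, hqQ, hPQ]; simp
  have hqp : qᴴ * p = 0 := by
    have := congrArg Matrix.conjTranspose hpq
    simpa using this
  set W := fromCols p q with hW
  set W' := fromCols p' q' with hW'
  have hWW : W * Wᴴ = P.1 + Q.1 := by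
    rw [hW, conjTranspose_fromCols_eq_fromRows_conjTranspose, fromCols_mul_fromRows, hpP, hqQ]
  have hWW' : W' * W'ᴴ = (Φ P).1 + (Φ Q).1 := by
    rw [hW', conjTranspose_fromCols_eq_fromRows_conjTranspose, fromCols_mul_fromRows, hpP', hqQ']
  have hW1 : Wᴴ * W = 1 := by
    rw [hW, conjTranspose_fromCols_eq_fromRows_conjTranspose, fromRows_mul_fromCols, hpp, hqq, hpq,
      hqp, fromBlocks_one]
  have hG : W'ᴴ * W' = fromBlocks 1 (p'ᴴ * q') (q'ᴴ * p') 1 := by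
    rw [hW', conjTranspose_fromCols_eq_fromRows_conjTranspose, fromRows_mul_fromCols, hpp', hqq']
  have hc : Fintype.card (Fin k ⊕ Fin k) = k + k := by simp
  -- images of small projections
  have hS : ∀ h : selfAdjoint (Matrix (Fin k ⊕ Fin k) (Fin k ⊕ Fin k) ℂ), h.1 * h.1 = h.1 →
      h.1.trace = k → sandLin W h ∈ projSet n k := by
    intro h h1 h2
    rw [mem_projSet_iff_aux, sandLin_coe]
    constructor
    · calc _ = W * (h.1 * (Wᴴ * W) * h.1) * Wᴴ := by simp only [Matrix.mul_assoc]
        _ = _ := by rw [hW1, Matrix.mul_one, h1]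
    · rw [Matrix.trace_mul_comm, ← Matrix.mul_assoc, hW1, Matrix.one_mul, h2]
  have hone : sandLin W 1 = P + Q := by
    apply Subtype.ext
    rw [sandLin_coe]
    simp [hWW]
  have hS' : ∀ h : selfAdjoint (Matrix (Fin k ⊕ Fin k) (Fin k ⊕ Fin k) ℂ), h.1 * h.1 = h.1 →
      h.1.trace = k → ∃ X ∈ projSet n k, ∃ Z ∈ projSet n k, X = Φ (sandLin W h) ∧
        X + Z = Φ P + Φ Q := by
    intro h h1 h2
    refine ⟨_, hΦ.mapsTo (hS h h1 h2), _, hΦ.mapsTo (hS (1 - h) ?_ ?_), rfl, ?_⟩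
    · simp [mul_sub, sub_mul, h1]
    · simp [h2]
    · rw [← map_add, ← map_add, ← map_add, ← hone]
      simp
  have hmemU : ∀ H, sandLin W H ∈ Submodule.span ℝ (projSet n k) := by
    intro H
    exact hermitian_span_aux' k hk1 hc ((Submodule.span ℝ (projSet n k)).comap (sandLin W))
      (fun h h1 h2 => Submodule.subset_span (hS h h1 h2)) H
  have hrange : ∀ H, Φ (sandLin W H) ∈ LinearMap.range (sandLin W') := by
    intro H
    refine hermitian_span_aux' k hk1 hc ((LinearMap.range (sandLin W')).comap (Φ ∘ₗ sandLin W))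
      (fun h h1 h2 => ?_) H
    obtain ⟨X, hX, Z, hZ, hXe, hXZ⟩ := hS' h h1 h2
    rw [Submodule.mem_comap, LinearMap.comp_apply, ← hXe]
    obtain ⟨Y, hY, hXY⟩ := sandwich_aux W' X.1 Z.1 X.2 hX.1 Z.2 hZ.1
      (by rw [hWW']; exact congrArg Subtype.val hXZ)
    exact ⟨⟨Y, hY⟩, Subtype.ext hXY.symm⟩
  have hconstr : ∀ H, Φ (sandLin W H) ∈ constrSub k (W' * W'ᴴ) := by
    intro H
    refine hermitian_span_aux' k hk1 hc ((constrSub k (W' * W'ᴴ)).comap (Φ ∘ₗ sandLin W))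
      (fun h h1 h2 => ?_) H
    obtain ⟨X, hX, Z, hZ, hXe, hXZ⟩ := hS' h h1 h2
    rw [Submodule.mem_comap, LinearMap.comp_apply, ← hXe]
    change (k : ℂ) • _ = _ • _
    rw [constraint_aux X.1 Z.1 (W' * W'ᴴ) hX.1 hZ.1 (by rw [hWW']; exact congrArg Subtype.val hXZ),
      ((mem_projSet_iff_aux X).1 hX).2]
  have hinj : Function.Injective (Φ ∘ₗ sandLin W) := by
    rw [← LinearMap.ker_eq_bot, LinearMap.ker_eq_bot']
    intro H hH
    have h0 := injOn_span_aux Φ hΦ _ (hmemU H) hH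
    apply Subtype.ext
    have h1 : W * H.1 * Wᴴ = 0 := congrArg Subtype.val h0
    calc H.1 = (Wᴴ * W) * H.1 * (Wᴴ * W) := by rw [hW1]; simp
      _ = Wᴴ * (W * H.1 * Wᴴ) * W := by simp only [Matrix.mul_assoc]
      _ = 0 := by rw [h1]; simp
  have hfd : FiniteDimensional ℝ (BH n) :=
    inferInstanceAs (FiniteDimensional ℝ (selfAdjoint.submodule ℝ (Matrix (Fin n) (Fin n) ℂ)))
  have hfd2 : FiniteDimensional ℝ (selfAdjoint (Matrix (Fin k ⊕ Fin k) (Fin k ⊕ Fin k) ℂ)) :=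
    inferInstanceAs (FiniteDimensional ℝ
      (selfAdjoint.submodule ℝ (Matrix (Fin k ⊕ Fin k) (Fin k ⊕ Fin k) ℂ)))
  have hle : LinearMap.range (Φ ∘ₗ sandLin W) ≤ LinearMap.range (sandLin W') := by
    rintro _ ⟨H, rfl⟩
    exact hrange H
  have e1 := LinearMap.finrank_range_of_inj hinj
  have e2 := LinearMap.finrank_range_add_finrank_ker (sandLin W')
  have e3 := Submodule.finrank_mono hle
  have hReq : LinearMap.range (Φ ∘ₗ sandLin W) = LinearMap.range (sandLin W') :=
    Submodule.eq_of_le_of_finrank_le hle (by omega)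
  have hker : LinearMap.ker (sandLin W') = ⊥ := by
    apply Submodule.finrank_eq_zero.1
    omega
  have hinj' := LinearMap.ker_eq_bot'.1 hker
  set G := W'ᴴ * W' with hGdef
  have hGH : Gᴴ = G := by simp [hGdef]
  have hG1 : G = 1 := by
    apply gram_aux k hk1 G
    · intro i
      rw [hG]
      rcases i with i | i <;> simp
    · intro H hH
      have h1 : sandLin W' ⟨H, hH⟩ ∈ LinearMap.range (Φ ∘ₗ sandLin W) := by
        rw [hReq]; exact ⟨_, rfl⟩
      obtain ⟨Y, hY⟩ := h1
      have h2 : sandLin W' ⟨H, hH⟩ ∈ constrSub k (W' * W'ᴴ) := by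
        rw [← hY]; exact hconstr Y
      have h3 : (k : ℂ) • ((W' * H * W'ᴴ) * (W' * W'ᴴ - 1) + (W' * W'ᴴ - 1) * (W' * H * W'ᴴ)) =
        (W' * H * W'ᴴ).trace • ((W' * W'ᴴ) * (W' * W'ᴴ - 1)) := h2
      have t : (W' * H * W'ᴴ).trace = (H * G).trace := by
        rw [Matrix.trace_mul_comm, ← Matrix.mul_assoc, Matrix.trace_mul_comm]
      have a1 : (W' * H * W'ᴴ) * (W' * W'ᴴ - 1) = W' * (H * (G - 1)) * W'ᴴ := by
        simp only [hGdef, Matrix.mul_sub, Matrix.sub_mul, Matrix.mul_assoc, Matrix.mul_one]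
      have a2 : (W' * W'ᴴ - 1) * (W' * H * W'ᴴ) = W' * ((G - 1) * H) * W'ᴴ := by
        simp only [hGdef, Matrix.mul_sub, Matrix.sub_mul, Matrix.mul_assoc, Matrix.one_mul]
      have a3 : (W' * W'ᴴ) * (W' * W'ᴴ - 1) = W' * (G - 1) * W'ᴴ := by
        simp only [hGdef, Matrix.mul_sub, Matrix.sub_mul, Matrix.mul_assoc, Matrix.mul_one]
      rw [t, a1, a2, a3] at h3
      have ht : star (H * G).trace = (H * G).trace := by
        rw [← Matrix.trace_conjTranspose, conjTranspose_mul, hGH, hH, Matrix.trace_mul_comm]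
      have hD : ((k : ℂ) • (H * (G - 1) + (G - 1) * H) - (H * G).trace • (G - 1))ᴴ =
          (k : ℂ) • (H * (G - 1) + (G - 1) * H) - (H * G).trace • (G - 1) := by
        simp only [conjTranspose_sub, conjTranspose_smul, conjTranspose_add, conjTranspose_mul, hH,
          hGH, conjTranspose_one, ht]
        rw [add_comm]
        simp
      have h4 := hinj' ⟨_, hD⟩ (by
        apply Subtype.ext
        rw [sandLin_coe]
        simp only [Matrix.mul_sub, Matrix.sub_mul, Matrix.mul_smul, Matrix.smul_mul, Matrix.mul_add,
          Matrix.add_mul] at h3 ⊢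
        rw [h3]
        simp)
      exact sub_eq_zero.1 (congrArg Subtype.val h4)
  have hfin : p'ᴴ * q' = 0 := by
    rw [hG, ← fromBlocks_one] at hG1
    exact (fromBlocks_inj.1 hG1).2.1
  rw [← hpP', ← hqQ', Matrix.mul_assoc, ← Matrix.mul_assoc p'ᴴ, hfin]
  simp
end
end

section
/- Let n ≥ 1, let 1 ≤ k ≤ n, and let Φ : B_H → B_H be an ℝ-linear map that maps the set P_k of rank-k Hermitian projections bijectively onto itself. Then for every natural number q ≥ 1 with q·k ≤ n, Φ maps the set P_{qk} of rank-(q·k) Hermitian projections bijectively onto itself. -/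
open Matrix

noncomputable section

theorem aux_rank_trace {n : ℕ} (A : Matrix (Fin n) (Fin n) ℂ) (h : A * A = A) :
    A.trace = (A.rank : ℂ) := by
  have h1 : IsIdempotentElem (Matrix.toLin' A) := by
    unfold IsIdempotentElem
    rw [Module.End.mul_eq_comp, ← Matrix.toLin'_mul, h]
  have h2 := (LinearMap.IsIdempotentElem.isProj_range _ h1).trace
  rw [Matrix.trace_toLin'_eq] at h2
  rw [h2]; rfl

theorem aux_mem {n k : ℕ} (P : BH n) : P ∈ projSet n k ↔
    P.1 * P.1 = P.1 ∧ P.1.trace = (k : ℂ) := by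
  constructor
  · rintro ⟨h, h'⟩
    exact ⟨h, by rw [aux_rank_trace _ h, h']⟩
  · rintro ⟨h, h'⟩
    refine ⟨h, ?_⟩
    rw [aux_rank_trace _ h] at h'
    exact_mod_cast h'

theorem aux_rank_add {n : ℕ} (A B : Matrix (Fin n) (Fin n) ℂ) :
    (A + B).rank ≤ A.rank + B.rank := by
  unfold Matrix.rank
  rw [Matrix.mulVecLin_add]
  refine le_trans (Submodule.finrank_mono (LinearMap.range_add_le _ _)) ?_
  exact Submodule.finrank_add_le_finrank_add_finrank _ _

theorem aux_frame {n m : ℕ} (S : Matrix (Fin n) (Fin n) ℂ) (hm : S.rank = m) :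
    ∃ (U : Matrix (Fin n) (Fin m) ℂ), Uᴴ * U = 1 ∧ U * Uᴴ * S = S ∧
      ∃ V : Matrix (Fin n) (Fin m) ℂ, U = S * V := by
  let W : Submodule ℂ (EuclideanSpace ℂ (Fin n)) := LinearMap.range (Matrix.toEuclideanLin S)
  have hW : Module.finrank ℂ W = m := by
    rw [← hm, Matrix.rank_eq_finrank_range_toLin S (EuclideanSpace.basisFun (Fin n) ℂ).toBasis
      (EuclideanSpace.basisFun (Fin n) ℂ).toBasis, ← Matrix.toEuclideanLin_eq_toLin_orthonormal]
  let b : OrthonormalBasis (Fin m) ℂ W := (stdOrthonormalBasis ℂ W).reindex (finCongr hW)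
  let U : Matrix (Fin n) (Fin m) ℂ := Matrix.of fun i j => (b j : EuclideanSpace ℂ (Fin n)) i
  refine ⟨U, ?_, ?_, ?_⟩
  · ext i j
    have := orthonormal_iff_ite.1 b.orthonormal i j
    rw [Matrix.one_apply, ← this]
    simp [Matrix.mul_apply, U, PiLp.inner_apply, mul_comm]
  · ext i j
    have hw : (Matrix.toEuclideanLin S (EuclideanSpace.single j 1)) ∈ W := ⟨_, rfl⟩
    have h := b.sum_repr' ⟨_, hw⟩
    have h2 := congrArg (fun w : W => (w : EuclideanSpace ℂ (Fin n)) i) h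
    have h3 : ∀ l, (Matrix.toEuclideanLin S (EuclideanSpace.single j 1)) l = S l j := by
      intro l; simp [Matrix.toLpLin_apply]
    simp [PiLp.inner_apply, h3] at h2
    rw [Matrix.mul_assoc, Matrix.mul_apply]
    conv_rhs => rw [← h2]
    simp [Matrix.mul_apply, U, mul_comm]
  · have : ∀ j, ∃ v : EuclideanSpace ℂ (Fin n), Matrix.toEuclideanLin S v = b j := fun j => (b j).2
    choose v hv using this
    refine ⟨Matrix.of fun i j => v j i, ?_⟩
    ext i j
    simp [U, ← hv, Matrix.toLpLin_apply, Matrix.mul_apply, Matrix.mulVec, dotProduct]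

theorem aux_frame_proj {n m : ℕ} (P : BH n) (hP : P ∈ projSet n m) :
    ∃ (U : Matrix (Fin n) (Fin m) ℂ), Uᴴ * U = 1 ∧ U * Uᴴ = P.1 := by
  obtain ⟨U, h1, h2, V, h3⟩ := aux_frame P.1 hP.2
  refine ⟨U, h1, ?_⟩
  have hPU : P.1 * U = U := by rw [h3, ← Matrix.mul_assoc, hP.1]
  have hh : P.1ᴴ = P.1 := P.2
  have := congrArg conjTranspose h2
  simp only [conjTranspose_mul, conjTranspose_conjTranspose, hh] at this
  rw [← Matrix.mul_assoc, hPU] at this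
  exact this

/-- conjugation by an isometry -/
def jm {n m : ℕ} (U : Matrix (Fin n) (Fin m) ℂ) : BH m →ₗ[ℝ] BH n where
  toFun A := ⟨U * A.1 * Uᴴ, by
    have : A.1ᴴ = A.1 := A.2
    rw [selfAdjoint.mem_iff, Matrix.star_eq_conjTranspose]
    simp [conjTranspose_mul, this, Matrix.mul_assoc]⟩
  map_add' A B := by ext1; simp [Matrix.mul_add, Matrix.add_mul]
  map_smul' c A := by ext1; simp

theorem jm_val {n m : ℕ} (U : Matrix (Fin n) (Fin m) ℂ) (A : BH m) :
    (jm U A).1 = U * A.1 * Uᴴ := rfl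

theorem jm_inj {n m : ℕ} (U : Matrix (Fin n) (Fin m) ℂ) (h : Uᴴ * U = 1) :
    Function.Injective (jm U) := by
  intro A B hAB
  have h1 := congrArg (fun X : BH n => Uᴴ * X.1 * U) hAB
  have h2 : ∀ A : BH m, Uᴴ * (jm U A).1 * U = A.1 := by
    intro A
    rw [jm_val, show Uᴴ * (U * A.1 * Uᴴ) * U = (Uᴴ * U) * A.1 * (Uᴴ * U) by
      simp only [Matrix.mul_assoc], h]; simp
  simp only [h2] at h1
  exact Subtype.ext h1

theorem jm_mul {n m : ℕ} (U : Matrix (Fin n) (Fin m) ℂ) (h : Uᴴ * U = 1)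
    (A B : Matrix (Fin m) (Fin m) ℂ) :
    (U * A * Uᴴ) * (U * B * Uᴴ) = U * (A * B) * Uᴴ := by
  rw [show (U * A * Uᴴ) * (U * B * Uᴴ) = U * A * (Uᴴ * U) * B * Uᴴ by
    simp only [Matrix.mul_assoc], h]
  simp only [Matrix.mul_assoc, Matrix.mul_one]

theorem jm_trace {n m : ℕ} (U : Matrix (Fin n) (Fin m) ℂ) (h : Uᴴ * U = 1)
    (A : Matrix (Fin m) (Fin m) ℂ) : (U * A * Uᴴ).trace = A.trace := by
  rw [Matrix.mul_assoc, Matrix.trace_mul_comm, Matrix.mul_assoc, h, Matrix.mul_one]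

theorem jm_mem {n m k : ℕ} (U : Matrix (Fin n) (Fin m) ℂ) (h : Uᴴ * U = 1) (A : BH m) :
    jm U A ∈ projSet n k ↔ A ∈ projSet m k := by
  rw [aux_mem, aux_mem, jm_val, jm_trace U h, jm_mul U h]
  refine and_congr_left fun _ => ?_
  constructor
  · intro hh
    have h1 := congrArg (fun X => Uᴴ * X * U) hh
    have h2 : ∀ A : Matrix (Fin m) (Fin m) ℂ, Uᴴ * (U * A * Uᴴ) * U = A := by
      intro A
      rw [show Uᴴ * (U * A * Uᴴ) * U = (Uᴴ * U) * A * (Uᴴ * U) by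
        simp only [Matrix.mul_assoc], h]; simp
    simpa only [h2] using h1
  · intro hh; rw [hh]

/-- diagonal Hermitian matrices -/
def dg {m : ℕ} : (Fin m → ℝ) →ₗ[ℝ] BH m where
  toFun d := ⟨Matrix.diagonal fun i => (d i : ℂ), by
    rw [selfAdjoint.mem_iff, Matrix.star_eq_conjTranspose, Matrix.diagonal_conjTranspose]
    congr 1; ext i; simp⟩
  map_add' d e := by ext1; simp
  map_smul' c d := by
    ext a b
    by_cases h : a = b <;> simp [Matrix.diagonal_apply, h]

theorem dg_val {m : ℕ} (d : Fin m → ℝ) : (dg d).1 = Matrix.diagonal fun i => (d i : ℂ) := rfl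

theorem dg_mem {m : ℕ} (T : Finset (Fin m)) :
    dg (fun i => if i ∈ T then 1 else 0) ∈ projSet m T.card := by
  rw [aux_mem]
  constructor
  · rw [dg_val, Matrix.diagonal_mul_diagonal]
    congr 1; ext i; split_ifs <;> simp
  · rw [dg_val, Matrix.trace_diagonal, ← Complex.ofReal_sum]
    simp

theorem aux_comb {M : Type*} [AddCommGroup M] [Module ℝ M] (N : Submodule ℝ M) {m k : ℕ}
    (hk : 0 < k) (hkm : k < m) (g : Fin m → M)
    (h : ∀ T : Finset (Fin m), T.card = k → ∑ i ∈ T, g i ∈ N) (i : Fin m) : g i ∈ N := by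
  have hd : ∀ i j, g i - g j ∈ N := by
    intro i j
    by_cases hij : i = j
    · simp [hij]
    obtain ⟨T, hT, hc⟩ := Finset.exists_subset_card_eq
      (s := (Finset.univ.erase i).erase j) (n := k - 1) (by
        rw [Finset.card_erase_of_mem (by simp [Ne.symm hij]), Finset.card_erase_of_mem (by simp)]
        simp; omega)
    have hi : i ∉ T := fun h => by have := hT h; simp at this
    have hj : j ∉ T := fun h => by have := hT h; simp at this
    have h1 := h (insert i T) (by rw [Finset.card_insert_of_notMem hi]; omega)
    have h2 := h (insert j T) (by rw [Finset.card_insert_of_notMem hj]; omega)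
    rw [Finset.sum_insert hi] at h1
    rw [Finset.sum_insert hj] at h2
    simpa using N.sub_mem h1 h2
  obtain ⟨T, -, hc⟩ := Finset.exists_subset_card_eq (s := (Finset.univ : Finset (Fin m))) (n := k)
    (by simp; omega)
  have h1 : (k : ℝ) • g i = ∑ j ∈ T, g j + ∑ j ∈ T, (g i - g j) := by
    rw [← Finset.sum_add_distrib]; simp [hc, Nat.cast_smul_eq_nsmul]
  have h2 : (k : ℝ) • g i ∈ N := by
    rw [h1]; exact N.add_mem (h T hc) (N.sum_mem fun j _ => hd i j)
  exact (N.smul_mem_iff (by exact_mod_cast hk.ne')).1 h2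

theorem aux_span {m k : ℕ} (hk : 0 < k) (hkm : k < m) :
    Submodule.span ℝ (projSet m k) = ⊤ := by
  rw [eq_top_iff]
  intro A _
  have hA : A.1.IsHermitian := A.2
  let V : Matrix (Fin m) (Fin m) ℂ := hA.eigenvectorUnitary
  have hV : Vᴴ * V = 1 := by
    rw [← Matrix.star_eq_conjTranspose]
    exact Unitary.coe_star_mul_self hA.eigenvectorUnitary
  have hs := hA.spectral_theorem
  rw [Unitary.conjStarAlgAut_apply] at hs
  have hAe : A = ∑ i, hA.eigenvalues i • jm V (dg (Pi.single i 1)) := by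
    have : ∑ i, hA.eigenvalues i • jm V (dg (Pi.single i 1)) = jm V (dg hA.eigenvalues) := by
      have h1 : ∀ i, hA.eigenvalues i • jm V (dg (Pi.single i 1)) =
          jm V (dg (hA.eigenvalues i • Pi.single i 1)) := fun i => by rw [map_smul, map_smul]
      rw [Finset.sum_congr rfl fun i _ => h1 i, ← map_sum, ← map_sum]
      congr 2
      ext a
      simp [Finset.sum_apply, Pi.single_apply]
    rw [this]
    exact Subtype.ext hs
  rw [hAe]
  refine Submodule.sum_mem _ fun i _ => Submodule.smul_mem _ _ ?_
  refine aux_comb _ hk hkm (fun i => jm V (dg (Pi.single i 1))) ?_ i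
  intro T hT
  refine Submodule.subset_span ?_
  rw [← map_sum]
  have : ∑ i ∈ T, dg (Pi.single i 1) = dg (fun i => if i ∈ T then 1 else 0) := by
    rw [← map_sum]
    congr 1
    ext a
    simp [Finset.sum_apply, Pi.single_apply]
  rw [this, jm_mem V hV, ← hT]
  exact dg_mem T

instance instFinBH (m : ℕ) : Module.Finite ℝ (selfAdjoint (Matrix (Fin m) (Fin m) ℂ)) :=
  Module.Finite.of_injective (selfAdjoint.submodule ℝ (Matrix (Fin m) (Fin m) ℂ)).subtype
    (Submodule.injective_subtype _)

instance instFinSk (m : ℕ) : Module.Finite ℝ (skewAdjoint (Matrix (Fin m) (Fin m) ℂ)) :=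
  Module.Finite.of_injective (skewAdjoint.submodule ℝ (Matrix (Fin m) (Fin m) ℂ)).subtype
    (Submodule.injective_subtype _)

theorem aux_finrank (m : ℕ) : Module.finrank ℝ (BH m) = m * m := by
  have e := (StarModule.decomposeProdAdjoint ℝ (Matrix (Fin m) (Fin m) ℂ)).finrank_eq
  rw [Module.finrank_prod, finrank_real_of_complex, Module.finrank_matrix] at e
  simp only [Fintype.card_fin, Module.finrank_self, mul_one] at e
  let f : BH m ≃ₗ[ℝ] skewAdjoint (Matrix (Fin m) (Fin m) ℂ) :=
    { toFun := fun A => ⟨Complex.I • A.1, by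
        have : star A.1 = A.1 := A.2
        rw [skewAdjoint.mem_iff, star_smul, this]; simp⟩
      invFun := fun A => ⟨-(Complex.I • A.1), by
        have : star A.1 = -A.1 := A.2
        rw [selfAdjoint.mem_iff, star_neg, star_smul, this]; simp⟩
      map_add' := fun A B => by ext1; simp
      map_smul' := fun c A => by ext1; exact smul_comm _ _ _
      left_inv := fun A => by ext1; simp [smul_smul]
      right_inv := fun A => by ext1; simp [smul_smul] }
  have h := f.finrank_eq
  change Module.finrank ℝ (selfAdjoint (Matrix (Fin m) (Fin m) ℂ)) = _ at h
  rw [← h] at e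
  change Module.finrank ℝ (selfAdjoint (Matrix (Fin m) (Fin m) ℂ)) = _
  omega

theorem sub_mem_proj {m k l : ℕ} (R : BH m) (hR : R ∈ projSet m k) (h : k + l = m) :
    1 - R ∈ projSet m l := by
  rw [aux_mem] at *
  obtain ⟨h1, h2⟩ := hR
  constructor
  · change (1 - R.1) * (1 - R.1) = 1 - R.1
    rw [sub_mul, mul_sub, mul_sub, h1]; simp
  · change (1 - R.1).trace = _
    rw [Matrix.trace_sub, h2, Matrix.trace_one, ← h]; simp

theorem orth_of_sum {n : ℕ} (E F : Matrix (Fin n) (Fin n) ℂ) (hE : E * E = E) (hF : F * F = F)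
    (h : (E + F) * (E + F) = E + F) : E * F = 0 := by
  have h1 : E * F + F * E = 0 := by
    have : (E + F) * (E + F) = E * E + F * F + (E * F + F * E) := by noncomm_ring
    rw [this, hE, hF] at h
    simpa using h
  have h2 : E * F + E * F * E = 0 := by
    have := congrArg (fun X => E * X) h1
    simpa [mul_add, ← Matrix.mul_assoc, hE] using this
  have h3 : E * F * E + E * F * E = 0 := by
    have := congrArg (fun X => X * E) h2
    simpa [add_mul, Matrix.mul_assoc, hE] using this
  have h4 : E * F * E = 0 := by
    rw [← two_smul ℂ] at h3
    simpa using h3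
  simpa [h4] using h2

open scoped ComplexOrder in
theorem supp_of_sum {n m : ℕ} (E F : BH n) (hE : E.1 * E.1 = E.1) (hF : F.1 * F.1 = F.1)
    (U : Matrix (Fin n) (Fin m) ℂ) (hUS : U * Uᴴ * (E + F).1 = (E + F).1) :
    E ∈ LinearMap.range (jm U) := by
  have eE : E.1ᴴ = E.1 := E.2
  have eF : F.1ᴴ = F.1 := F.2
  have hUS' : U * Uᴴ * (E.1 + F.1) = E.1 + F.1 := hUS
  set Q : Matrix (Fin n) (Fin n) ℂ := 1 - U * Uᴴ with hQ
  have hQh : Qᴴ = Q := by simp [hQ]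
  have h0 : Q * E.1 * Q + Q * F.1 * Q = 0 := by
    rw [← add_mul, ← mul_add, hQ, sub_mul, hUS']; simp
  have k1 : ∀ X : Matrix (Fin n) (Fin n) ℂ, Xᴴ = X → X * X = X → Q * X * Q = (X * Q)ᴴ * (X * Q) := by
    intro X hX hXX
    rw [conjTranspose_mul, hX, hQh, Matrix.mul_assoc, Matrix.mul_assoc, ← Matrix.mul_assoc X X, hXX]
  rw [k1 _ eE hE, k1 _ eF hF] at h0
  have hEQ : E.1 * Q = 0 := by
    have t := congrArg Matrix.trace h0
    rw [Matrix.trace_add, Matrix.trace_zero] at t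
    have p1 := (Matrix.posSemidef_conjTranspose_mul_self (E.1 * Q)).trace_nonneg
    have p2 := (Matrix.posSemidef_conjTranspose_mul_self (F.1 * Q)).trace_nonneg
    exact Matrix.trace_conjTranspose_mul_self_eq_zero_iff.1
      ((add_eq_zero_iff_of_nonneg p1 p2).1 t).1
  have hE1 : E.1 * (U * Uᴴ) = E.1 := by
    rw [hQ, mul_sub, mul_one, sub_eq_zero] at hEQ
    exact hEQ.symm
  have hE2 : (U * Uᴴ) * E.1 = E.1 := by
    have := congrArg conjTranspose hE1
    simpa [conjTranspose_mul, eE] using this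
  refine ⟨jm Uᴴ E, Subtype.ext ?_⟩
  rw [jm_val, jm_val, conjTranspose_conjTranspose]
  calc U * (Uᴴ * E.1 * U) * Uᴴ = (U * Uᴴ * E.1) * (U * Uᴴ) := by simp only [Matrix.mul_assoc]
    _ = E.1 := by rw [hE2, hE1]

theorem aux_inj {n k : ℕ} (hk : 0 < k) (hkn : k < n) (Φ : BH n →ₗ[ℝ] BH n)
    (hΦ : Set.BijOn Φ (projSet n k) (projSet n k)) : Function.Injective Φ := by
  rw [LinearMap.injective_iff_surjective, ← LinearMap.range_eq_top, eq_top_iff,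
    ← aux_span hk hkn, Submodule.span_le]
  intro P hP
  obtain ⟨Q, _, rfl⟩ := hΦ.surjOn hP
  exact ⟨Q, rfl⟩

open scoped ComplexOrder in
theorem aux_orth {n k : ℕ} (hk : 0 < k) (hkn : k < n) (Φ : BH n →ₗ[ℝ] BH n)
    (hΦ : Set.BijOn Φ (projSet n k) (projSet n k)) (P Q : BH n) (hP : P ∈ projSet n k)
    (hQ : Q ∈ projSet n k) (hPQ : P.1 * Q.1 = 0) : (Φ P).1 * (Φ Q).1 = 0 := by
  have hinj := aux_inj hk hkn Φ hΦ
  have hP' := hΦ.mapsTo hP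
  have hQ' := hΦ.mapsTo hQ
  have eP : P.1ᴴ = P.1 := P.2
  have eQ : Q.1ᴴ = Q.1 := Q.2
  have hQP : Q.1 * P.1 = 0 := by
    have := congrArg conjTranspose hPQ
    simpa [conjTranspose_mul, eP, eQ] using this
  have hS : P + Q ∈ projSet n (2 * k) := by
    have a := (aux_mem P).1 hP
    have b := (aux_mem Q).1 hQ
    rw [aux_mem]
    constructor
    · change (P.1 + Q.1) * (P.1 + Q.1) = P.1 + Q.1
      rw [add_mul, mul_add, mul_add, a.1, b.1, hPQ, hQP]; simp
    · change (P.1 + Q.1).trace = _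
      rw [Matrix.trace_add, a.2, b.2]; push_cast; ring
  obtain ⟨U, hU, hUS⟩ := aux_frame_proj _ hS
  have hjS : jm U 1 = P + Q := Subtype.ext (by
    rw [jm_val, ← hUS]; change U * 1 * Uᴴ = _; rw [Matrix.mul_one])
  have hm : ∃ m, (Φ (P + Q)).1.rank = m := ⟨_, rfl⟩
  obtain ⟨m, hm⟩ := hm
  have hm2 : m ≤ 2 * k := by
    rw [← hm, map_add]
    refine (aux_rank_add _ _).trans ?_
    rw [hP'.2, hQ'.2]; omega
  obtain ⟨U', hU', hUS', -⟩ := aux_frame _ hm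
  have hrange : LinearMap.range (Φ ∘ₗ jm U) ≤ LinearMap.range (jm U') := by
    rw [LinearMap.range_eq_map, ← aux_span hk (show k < 2 * k by omega), Submodule.map_span,
      Submodule.span_le]
    rintro _ ⟨R, hR, rfl⟩
    have h1 : Φ (jm U R) ∈ projSet n k := hΦ.mapsTo ((jm_mem U hU R).2 hR)
    have h2 : Φ (jm U (1 - R)) ∈ projSet n k :=
      hΦ.mapsTo ((jm_mem U hU _).2 (sub_mem_proj R hR (by omega)))
    refine supp_of_sum _ _ h1.1 h2.1 U' ?_
    rw [← map_add, ← map_add, add_sub_cancel, hjS]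
    exact hUS'
  have f1 : Module.finrank ℝ (LinearMap.range (Φ ∘ₗ jm U)) = (2 * k) * (2 * k) := by
    rw [LinearMap.finrank_range_of_inj (f := Φ ∘ₗ jm U) (hinj.comp (jm_inj U hU)), aux_finrank]
  have f2 : Module.finrank ℝ (LinearMap.range (jm U')) = m * m := by
    rw [LinearMap.finrank_range_of_inj (jm_inj U' hU'), aux_finrank]
  have f3 := Submodule.finrank_mono hrange
  rw [f1, f2] at f3
  have hmk : m = 2 * k := le_antisymm hm2 (Nat.mul_self_le_mul_self_iff.1 f3)
  subst hmk
  have hreq := Submodule.eq_of_le_of_finrank_eq hrange (by rw [f1, f2])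
  have hT : Φ (P + Q) ∈ LinearMap.range (jm U') := by
    rw [← hreq, ← hjS]; exact ⟨1, rfl⟩
  obtain ⟨T, hT⟩ := hT
  have key : ∀ R ∈ projSet (2 * k) k, T - R ∈ projSet (2 * k) k := by
    intro R hR
    have h1 : jm U' R ∈ projSet n k := (jm_mem U' hU' R).2 hR
    have h2 : jm U' R ∈ LinearMap.range (Φ ∘ₗ jm U) := by rw [hreq]; exact ⟨R, rfl⟩
    obtain ⟨A, hA⟩ := h2
    obtain ⟨R0, hR0, hR0'⟩ := hΦ.surjOn h1
    have h3 : jm U A = R0 := hinj (by rw [hR0', ← hA]; rfl)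
    rw [← h3] at hR0
    have hA' := (jm_mem U hU A).1 hR0
    have h4 := hΦ.mapsTo ((jm_mem U hU _).2 (sub_mem_proj A hA' (show k + k = 2 * k by omega)))
    rw [map_sub, hjS, map_sub, ← hT, show Φ (jm U A) = jm U' R from hA, ← map_sub] at h4
    exact (jm_mem U' hU' _).1 h4
  have hex : ∃ R, R ∈ projSet (2 * k) k := by
    obtain ⟨t, -, hc⟩ := Finset.exists_subset_card_eq
      (s := (Finset.univ : Finset (Fin (2 * k)))) (n := k) (by simp; omega)
    have h := dg_mem t
    rw [hc] at h
    exact ⟨_, h⟩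
  obtain ⟨R, hR⟩ := hex
  have k1 : (T.1 - R.1) * (T.1 - R.1) = T.1 - R.1 := (key R hR).1
  have k2 : (T.1 - (1 - R.1)) * (T.1 - (1 - R.1)) = T.1 - (1 - R.1) :=
    (key _ (sub_mem_proj R hR (by omega))).1
  have k3 : R.1 * R.1 = R.1 := hR.1
  have k4 : (T.1 - 1) * (T.1 - 1) = 0 := by
    have e1 : (2 : ℂ) • ((T.1 - 1) * (T.1 - 1)) =
        ((T.1 - R.1) * (T.1 - R.1) - (T.1 - R.1)) +
        ((T.1 - (1 - R.1)) * (T.1 - (1 - R.1)) - (T.1 - (1 - R.1)))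
        - (2 : ℂ) • (R.1 * R.1 - R.1) := by
      simp only [two_smul]; noncomm_ring
    rw [k1, k2, k3] at e1
    simpa using e1
  have hT1 : T.1 - 1 = 0 := by
    have eT : (T.1 - 1)ᴴ = T.1 - 1 := by
      have : T.1ᴴ = T.1 := T.2
      simp [this]
    rw [← Matrix.conjTranspose_mul_self_eq_zero, eT, k4]
  have hid : (Φ (P + Q)).1 * (Φ (P + Q)).1 = (Φ (P + Q)).1 := by
    rw [← hT, jm_val, jm_mul U' hU', sub_eq_zero.1 hT1, Matrix.mul_one]
  rw [map_add] at hid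
  exact orth_of_sum _ _ hP'.1 hQ'.1 hid

theorem aux_mapsTo {n k : ℕ} (hk : 0 < k) (hkn : k < n) (Φ : BH n →ₗ[ℝ] BH n)
    (hΦ : Set.BijOn Φ (projSet n k) (projSet n k)) (q : ℕ) :
    Set.MapsTo Φ (projSet n (q * k)) (projSet n (q * k)) := by
  intro X hX
  obtain ⟨U, hU, hUX⟩ := aux_frame_proj X hX
  let t : Fin q → Finset (Fin (q * k)) := fun i =>
    Finset.univ.map ⟨fun j : Fin k => finProdFinEquiv (i, j), fun a b h => by simpa using h⟩
  let D : Fin q → BH (q * k) := fun i => dg (fun a => if a ∈ t i then 1 else 0)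
  have ht : ∀ i a, a ∈ t i ↔ (finProdFinEquiv.symm a).1 = i := by
    intro i a
    obtain ⟨⟨x, y⟩, rfl⟩ := finProdFinEquiv.surjective a
    rw [Equiv.symm_apply_apply]
    constructor
    · intro h
      obtain ⟨w, _, h⟩ := Finset.mem_map.1 h
      have h' : (i, w) = (x, y) := finProdFinEquiv.injective h
      exact (congrArg Prod.fst h').symm
    · rintro rfl
      exact Finset.mem_map.2 ⟨y, Finset.mem_univ _, rfl⟩
  have hc : ∀ i, (t i).card = k := fun i => by simp [t]
  have hD : ∀ i, D i ∈ projSet (q * k) k := fun i => by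
    have := dg_mem (t i)
    rwa [hc i] at this
  have hD0 : ∀ i j, i ≠ j → (D i).1 * (D j).1 = 0 := by
    intro i j hij
    simp only [D, dg_val, Matrix.diagonal_mul_diagonal]
    rw [← Matrix.diagonal_zero]
    congr 1
    ext a
    by_cases h : a ∈ t i
    · have : a ∉ t j := fun h' => hij (((ht i a).1 h).symm.trans ((ht j a).1 h'))
      simp [this]
    · simp [h]
  have hD1 : ∑ i, D i = 1 := by
    rw [← map_sum]
    apply Subtype.ext
    rw [dg_val]
    change _ = (1 : Matrix (Fin (q * k)) (Fin (q * k)) ℂ)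
    rw [← Matrix.diagonal_one]
    congr 1
    ext a
    simp [Finset.sum_apply, ht]
  have hXs : X = ∑ i, jm U (D i) := by
    rw [← map_sum, hD1]
    apply Subtype.ext
    rw [jm_val, ← hUX]; change _ = U * 1 * Uᴴ; rw [Matrix.mul_one]
  have hE : ∀ i, Φ (jm U (D i)) ∈ projSet n k := fun i =>
    hΦ.mapsTo ((jm_mem U hU _).2 (hD i))
  have hE0 : ∀ i j, i ≠ j → (Φ (jm U (D i))).1 * (Φ (jm U (D j))).1 = 0 := by
    intro i j hij
    refine aux_orth hk hkn Φ hΦ _ _ ((jm_mem U hU _).2 (hD i)) ((jm_mem U hU _).2 (hD j)) ?_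
    rw [jm_val, jm_val, jm_mul U hU, hD0 i j hij]; simp
  have hval : (Φ X).1 = ∑ i, (Φ (jm U (D i))).1 := by
    rw [hXs, map_sum]
    exact AddSubgroup.val_finsetSum _ _ _
  rw [aux_mem, hval]
  constructor
  · rw [Finset.sum_mul]
    refine Finset.sum_congr rfl fun i _ => ?_
    rw [Finset.mul_sum, Finset.sum_eq_single i]
    · exact (hE i).1
    · intro j _ hj; exact hE0 i j hj.symm
    · simp
  · rw [Matrix.trace_sum, Finset.sum_congr rfl fun i _ => ((aux_mem _).1 (hE i)).2]
    simp

theorem stmt_1 (n k : ℕ) (hn : 1 ≤ n) (hk1 : 1 ≤ k) (hkn : k ≤ n)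
    (Φ : BH n →ₗ[ℝ] BH n)
    (hΦ : Set.BijOn Φ (projSet n k) (projSet n k)) :
    ∀ q : ℕ, 1 ≤ q → q * k ≤ n →
      Set.BijOn Φ (projSet n (q * k)) (projSet n (q * k)) := by
  intro q hq hqn
  rcases Nat.eq_or_lt_of_le hq with rfl | hq2
  · simpa using hΦ
  have hlt : k < n := by nlinarith
  have hinj := aux_inj hk1 hlt Φ hΦ
  let e : BH n ≃ₗ[ℝ] BH n := LinearEquiv.ofInjectiveEndo Φ hinj
  have he : ∀ x, e x = Φ x := fun x => rfl
  have hinv : Set.BijOn (e.symm : BH n →ₗ[ℝ] BH n) (projSet n k) (projSet n k) := by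
    refine ⟨?_, e.symm.injective.injOn, ?_⟩
    · intro P hP
      obtain ⟨Q, hQ, rfl⟩ := hΦ.surjOn hP
      have : e.symm (Φ Q) = Q := by rw [← he, e.symm_apply_apply]
      change e.symm (Φ Q) ∈ _
      rwa [this]
    · intro P hP
      exact ⟨Φ P, hΦ.mapsTo hP, by
        change e.symm (Φ P) = P
        rw [← he, e.symm_apply_apply]⟩
  refine ⟨aux_mapsTo hk1 hlt Φ hΦ q, hinj.injOn, ?_⟩
  intro P hP
  refine ⟨e.symm P, aux_mapsTo hk1 hlt _ hinv q hP, ?_⟩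
  rw [← he, e.apply_symm_apply]
end
end
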